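/- Fix integers n ≥ 1 and d ≥ 0. Call an invertible real n×n matrix semisimple if it is diagonalizable as a complex matrix (equivalently, its minimal polynomial is squarefree over ℂ); let Hom(ℤ^{2d}, GL(n,ℝ))⁺ be the space of commuting 2d-tuples of semisimple elements of GL(n,ℝ). Then the map Hom(ℤ^{2d}, O(n))/O(n) → Hom(ℤ^{2d}, GL(n,ℝ))⁺/GL(n,ℝ) induced by the inclusion O(n) ↪ GL(n,ℝ) is continuous and injective, and its image is a strong deformation retract of Hom(ℤ^{2d}, GL(n,ℝ))⁺/GL(n,ℝ). -/

import Mathlib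

open Matrix

/-- The space `Hom(ℤ^m, G)` of commuting `m`-tuples with entries in a subset `G`
of a monoid `M`, as a subset of `M^m` (with the subspace topology). -/
def commTuples {M : Type*} [Monoid M] (m : ℕ) (G : Set M) : Set (Fin m → M) :=
  {f | (∀ i, f i ∈ G) ∧ ∀ i j, f i * f j = f j * f i}

/-- Simultaneous conjugation, by elements of `G` (together with their inverses in `G`),
of tuples lying in a subset `S` of `M^m`. -/
def conjRel {M : Type*} [Monoid M] {m : ℕ} (G : Set M) (S : Set (Fin m → M)) :
    S → S → Prop := fun x y =>
  ∃ g gi : M, g ∈ G ∧ gi ∈ G ∧ g * gi = 1 ∧ gi * g = 1 ∧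
    ∀ i, g * (x : Fin m → M) i * gi = (y : Fin m → M) i

/-- The conjugation orbit space `S/G`, with the quotient topology. -/
abbrev RepSpace {M : Type*} [Monoid M] [TopologicalSpace M] {m : ℕ} (G : Set M)
    (S : Set (Fin m → M)) : Type _ := Quot (conjRel G S)

/-- `A` is a strong deformation retract of `X`. -/
def IsStrongDeformationRetract {X : Type*} [TopologicalSpace X] (A : Set X) : Prop :=
  ∃ H : X × unitInterval → X, Continuous H ∧
    (∀ x, H (x, 0) = x) ∧ (∀ x, H (x, 1) ∈ A) ∧ (∀ a ∈ A, ∀ t, H (a, t) = a)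

/-- A complex square matrix is semisimple if it is diagonalizable over `ℂ`. -/
def IsSemisimpleMat {n : ℕ} (A : Matrix (Fin n) (Fin n) ℂ) : Prop :=
  ∃ P Pi : Matrix (Fin n) (Fin n) ℂ, P * Pi = 1 ∧ Pi * P = 1 ∧ (Pi * A * P).IsDiag

/-- The subspace `Hom(ℤ^m, G)⁺` of commuting `m`-tuples in `G` all of whose entries
are semisimple. -/
def ssTuples (m : ℕ) {n : ℕ} (G : Set (Matrix (Fin n) (Fin n) ℂ)) :
    Set (Fin m → Matrix (Fin n) (Fin n) ℂ) :=
  {f | f ∈ commTuples m G ∧ ∀ i, IsSemisimpleMat (f i)}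

/-- `GL(n,ℂ)` as the set of invertible complex `n × n` matrices. -/
def GLset (n : ℕ) : Set (Matrix (Fin n) (Fin n) ℂ) := {A | IsUnit A}

/-- `U(n)` as a set of complex `n × n` matrices. -/
def Uset (n : ℕ) : Set (Matrix (Fin n) (Fin n) ℂ) := Matrix.unitaryGroup (Fin n) ℂ

/-- `SL(n,ℂ)` as the set of complex `n × n` matrices of determinant one. -/
def SLset (n : ℕ) : Set (Matrix (Fin n) (Fin n) ℂ) := {A | A.det = 1}

/-- `SU(n)` as a set of complex `n × n` matrices. -/
def SUset (n : ℕ) : Set (Matrix (Fin n) (Fin n) ℂ) :=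
  {A | A ∈ Matrix.unitaryGroup (Fin n) ℂ ∧ A.det = 1}

/-- A real square matrix is semisimple if it is diagonalizable as a complex matrix. -/
def IsSemisimpleMatR {n : ℕ} (A : Matrix (Fin n) (Fin n) ℝ) : Prop :=
  IsSemisimpleMat (A.map (Complex.ofReal))

/-- `GL(n,ℝ)` as the set of invertible real `n × n` matrices. -/
def GLRset (n : ℕ) : Set (Matrix (Fin n) (Fin n) ℝ) := {A | IsUnit A}

/-- `O(n)` as a set of real `n × n` matrices. -/
def Oset (n : ℕ) : Set (Matrix (Fin n) (Fin n) ℝ) := Matrix.orthogonalGroup (Fin n) ℝ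

/-- The subspace `Hom(ℤ^m, GL(n,ℝ))⁺` of commuting `m`-tuples of semisimple
(i.e. diagonalizable over `ℂ`) elements of `GL(n,ℝ)`. -/
def ssTuplesR (m n : ℕ) : Set (Fin m → Matrix (Fin n) (Fin n) ℝ) :=
  {f | f ∈ commTuples m (GLRset n) ∧ ∀ i, IsSemisimpleMatR (f i)}

section Diagonalization

variable {n : ℕ}

/-- A matrix intertwining two diagonal matrices also intertwines their images under any function. -/
theorem mul_diagonal_comp_of_intertwines {R : Type*} [CommRing R] [IsDomain R] {d d' : Fin n → R}
    {X : Matrix (Fin n) (Fin n) R} (f : R → R) (h : X * diagonal d = diagonal d' * X) :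
    X * diagonal (f ∘ d) = diagonal (f ∘ d') * X := by
  ext i j
  have hij := congrFun (congrFun h i) j
  simp only [mul_diagonal, diagonal_mul, Function.comp_apply] at hij ⊢
  by_cases hX : X i j = 0
  · simp [hX]
  · rw [mul_comm] at hij
    rw [mul_right_cancel₀ hX hij, mul_comm]

/-- Functional calculus for diagonalizable matrices is natural with respect to intertwiners. -/
theorem mul_conj_diagonal_comp_of_intertwines {R : Type*} [CommRing R] [IsDomain R]
    {d d' : Fin n → R} {G P Pi P' Pi' : Matrix (Fin n) (Fin n) R} (f : R → R)
    (hP : Pi * P = 1) (hP₂ : P * Pi = 1) (hP' : Pi' * P' = 1) (hP'₂ : P' * Pi' = 1)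
    (h : G * (P * diagonal d * Pi) = P' * diagonal d' * Pi' * G) :
    G * (P * diagonal (f ∘ d) * Pi) = P' * diagonal (f ∘ d') * Pi' * G := by
  have key : (Pi' * G * P) * diagonal d = diagonal d' * (Pi' * G * P) := by
    calc (Pi' * G * P) * diagonal d = Pi' * (G * (P * diagonal d * Pi)) * P := by
          simp only [Matrix.mul_assoc, hP, Matrix.mul_one]
      _ = (Pi' * P') * diagonal d' * (Pi' * G * P) := by
          rw [h]; simp only [Matrix.mul_assoc]
      _ = _ := by rw [hP', Matrix.one_mul]
  have key' := mul_diagonal_comp_of_intertwines f key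
  calc G * (P * diagonal (f ∘ d) * Pi) = (P' * Pi') * (G * (P * diagonal (f ∘ d) * Pi)) := by
        rw [hP'₂, Matrix.one_mul]
    _ = P' * ((Pi' * G * P) * diagonal (f ∘ d)) * Pi := by simp only [Matrix.mul_assoc]
    _ = P' * diagonal (f ∘ d') * Pi' * G * (P * Pi) := by
        rw [key']; simp only [Matrix.mul_assoc]
    _ = _ := by rw [hP₂, Matrix.mul_one]

theorem conj_mul_conj {R : Type*} [CommRing R] {P Pi A B : Matrix (Fin n) (Fin n) R}
    (hP : Pi * P = 1) : P * A * Pi * (P * B * Pi) = P * (A * B) * Pi := by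
  calc P * A * Pi * (P * B * Pi) = P * A * (Pi * P) * B * Pi := by simp only [Matrix.mul_assoc]
    _ = _ := by rw [hP, Matrix.mul_one]; simp only [Matrix.mul_assoc]

theorem IsSemisimpleMat.exists_eq_conj_diagonal {A : Matrix (Fin n) (Fin n) ℂ}
    (h : IsSemisimpleMat A) : ∃ (P Pi : Matrix (Fin n) (Fin n) ℂ) (d : Fin n → ℂ),
      P * Pi = 1 ∧ Pi * P = 1 ∧ A = P * diagonal d * Pi := by
  obtain ⟨P, Pi, h₁, h₂, hd⟩ := h
  refine ⟨P, Pi, (Pi * A * P).diag, h₁, h₂, ?_⟩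
  rw [hd.diagonal_diag]
  calc A = (P * Pi) * A * (P * Pi) := by rw [h₁, Matrix.one_mul, Matrix.mul_one]
    _ = _ := by simp only [Matrix.mul_assoc]

theorem isSemisimpleMat_conj_diagonal {P Pi : Matrix (Fin n) (Fin n) ℂ} (d : Fin n → ℂ)
    (h₁ : P * Pi = 1) (h₂ : Pi * P = 1) : IsSemisimpleMat (P * diagonal d * Pi) := by
  refine ⟨P, Pi, h₁, h₂, ?_⟩
  have : Pi * (P * diagonal d * Pi) * P = diagonal d := by
    calc Pi * (P * diagonal d * Pi) * P = (Pi * P) * diagonal d * (Pi * P) := by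
          simp only [Matrix.mul_assoc]
      _ = _ := by rw [h₂, Matrix.one_mul, Matrix.mul_one]
  rw [this]
  exact isDiag_diagonal d

theorem mulVec_col_of_eq_conj_diagonal {R : Type*} [CommRing R]
    {A P Pi : Matrix (Fin n) (Fin n) R} {d : Fin n → R}
    (h₂ : Pi * P = 1) (hA : A = P * diagonal d * Pi) (k : Fin n) :
    A *ᵥ P.col k = d k • P.col k := by
  have h : A * P = P * diagonal d := by
    rw [hA, Matrix.mul_assoc, h₂, Matrix.mul_one]
  ext i
  have := congrFun (congrFun h i) k
  simp only [mul_diagonal] at this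
  simpa [Matrix.mul_apply, mulVec, dotProduct, mul_comm] using this

theorem IsSemisimpleMat.iSup_eigenspace_eq_top {A : Matrix (Fin n) (Fin n) ℂ}
    (h : IsSemisimpleMat A) : ⨆ μ, Module.End.eigenspace (toLin' A) μ = ⊤ := by
  obtain ⟨P, Pi, d, h₁, h₂, hA⟩ := h.exists_eq_conj_diagonal
  rw [eq_top_iff]
  intro v _
  have hv : v = ∑ k, (Pi *ᵥ v) k • P.col k := by
    calc v = P *ᵥ (Pi *ᵥ v) := by rw [mulVec_mulVec, h₁, one_mulVec]
      _ = _ := by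
        ext i
        simp [mulVec, dotProduct, mul_comm]
  rw [hv]
  refine Submodule.sum_mem _ fun k _ => Submodule.smul_mem _ _ ?_
  refine Submodule.mem_iSup_of_mem (d k) ?_
  rw [Module.End.mem_eigenspace_iff]
  simpa using mulVec_col_of_eq_conj_diagonal h₂ hA k

theorem conj_diagonal_sub_smul_pow {R : Type*} [CommRing R] {P Pi : Matrix (Fin n) (Fin n) R}
    {d : Fin n → R} (h₁ : P * Pi = 1) (h₂ : Pi * P = 1) (μ : R) (k : ℕ) :
    (P * diagonal d * Pi - μ • 1) ^ k = P * diagonal (fun j => (d j - μ) ^ k) * Pi := by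
  induction k with
  | zero => simp [h₁]
  | succ k ih =>
    have : P * diagonal d * Pi - μ • 1 = P * diagonal (fun j => d j - μ) * Pi := by
      have h : (diagonal fun j => d j - μ) = diagonal d - μ • (1 : Matrix (Fin n) (Fin n) R) := by
        ext i j
        by_cases hij : i = j <;> simp [hij]
      rw [h, Matrix.mul_sub, Matrix.sub_mul, Matrix.mul_smul, Matrix.smul_mul, Matrix.mul_one, h₁]
    rw [pow_succ, ih, this, conj_mul_conj h₂, diagonal_mul_diagonal]
    simp [pow_succ]

theorem IsSemisimpleMat.maxGenEigenspace_le_eigenspace {A : Matrix (Fin n) (Fin n) ℂ}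
    (h : IsSemisimpleMat A) (μ : ℂ) :
    Module.End.maxGenEigenspace (toLin' A) μ ≤ Module.End.eigenspace (toLin' A) μ := by
  obtain ⟨P, Pi, d, h₁, h₂, hA⟩ := h.exists_eq_conj_diagonal
  intro v hv
  obtain ⟨k, hk⟩ := (Module.End.mem_maxGenEigenspace _ _ _).1 hv
  have hlin : toLin' A - μ • 1 = toLin' (A - μ • 1) := by
    simp [map_sub, map_smul, toLin'_one]; rfl
  have hpow (k : ℕ) : ((toLin' A - μ • 1) ^ k) v = P *ᵥ (diagonal (fun j => (d j - μ) ^ k) *ᵥ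
      (Pi *ᵥ v)) := by
    rw [hlin, ← toLin'_pow, toLin'_apply, hA, conj_diagonal_sub_smul_pow h₁ h₂, mulVec_mulVec,
      mulVec_mulVec]
  have h0 : diagonal (fun j => (d j - μ) ^ k) *ᵥ (Pi *ᵥ v) = 0 := by
    have := congrArg (Pi *ᵥ ·) ((hpow k).symm.trans hk)
    simpa [mulVec_mulVec, ← Matrix.mul_assoc, h₂] using this
  have h1 : diagonal (fun j => (d j - μ) ^ 1) *ᵥ (Pi *ᵥ v) = 0 := by
    ext j
    have := congrFun h0 j
    rw [mulVec_diagonal] at this ⊢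
    rcases mul_eq_zero.1 this with h | h
    · simp [eq_zero_of_pow_eq_zero h]
    · simp [h]
  rw [Module.End.mem_eigenspace_iff, ← sub_eq_zero]
  have := hpow 1
  rw [h1, mulVec_zero] at this
  simpa using this

/-- Commuting diagonalizable complex matrices are simultaneously diagonalizable. -/
theorem exists_simultaneous_conj_diagonal {ι : Type*} {A : ι → Matrix (Fin n) (Fin n) ℂ}
    (hc : ∀ i j, A i * A j = A j * A i) (hs : ∀ i, IsSemisimpleMat (A i)) :
    ∃ (P Pi : Matrix (Fin n) (Fin n) ℂ) (D : ι → Fin n → ℂ), P * Pi = 1 ∧ Pi * P = 1 ∧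
      ∀ i, A i = P * diagonal (D i) * Pi := by
  let s : Set (Fin n → ℂ) := {v | ∀ i, ∃ μ : ℂ, A i *ᵥ v = μ • v}
  have hspan : ⊤ ≤ Submodule.span ℂ s := by
    rw [← Module.End.iSup_iInf_maxGenEigenspace_eq_top_of_iSup_maxGenEigenspace_eq_top_of_commute
      (fun i => toLin' (A i))]
    · refine iSup_le fun χ v hv => Submodule.subset_span fun i => ⟨χ i, ?_⟩
      have := (hs i).maxGenEigenspace_le_eigenspace (χ i) ((Submodule.mem_iInf _).1 hv i)
      rwa [Module.End.mem_eigenspace_iff, toLin'_apply] at this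
    · intro i j _
      change toLin' (A i) * toLin' (A j) = toLin' (A j) * toLin' (A i)
      rw [Module.End.mul_eq_comp, Module.End.mul_eq_comp, ← toLin'_mul, ← toLin'_mul, hc i j]
    · intro i
      rw [eq_top_iff, ← (hs i).iSup_eigenspace_eq_top]
      exact iSup_mono fun μ => (Module.End.genEigenspace _ _).mono le_top
  let b₀ := Module.Basis.ofSpan hspan
  let b : Module.Basis (Fin n) ℂ (Fin n → ℂ) := b₀.reindex (b₀.indexEquiv (Pi.basisFun ℂ (Fin n)))
  have hb : ∀ k, b k ∈ s := by
    intro k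
    apply Module.Basis.ofSpan_subset hspan
    simp [b, b₀]
  choose D hD using fun i k => hb k i
  let P := (Pi.basisFun ℂ (Fin n)).toMatrix b
  let Pi := b.toMatrix (Pi.basisFun ℂ (Fin n))
  have h₁ : P * Pi = 1 := Module.Basis.toMatrix_mul_toMatrix_flip _ _
  have h₂ : Pi * P = 1 := Module.Basis.toMatrix_mul_toMatrix_flip _ _
  refine ⟨P, Pi, D, h₁, h₂, fun i => ?_⟩
  have : A i * P = P * diagonal (D i) := by
    ext j k
    have := congrFun (hD i k) j
    rw [mul_diagonal]
    simpa [P, Matrix.mul_apply, mulVec, dotProduct, Module.Basis.toMatrix_apply, mul_comm]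
      using this
  rw [← this, Matrix.mul_assoc, h₁, Matrix.mul_one]

end Diagonalization

section Hermitian

variable {n : ℕ}

theorem Matrix.IsHermitian.exists_unitary_conj_diagonal {𝕜 : Type*} [RCLike 𝕜]
    {R : Matrix (Fin n) (Fin n) 𝕜} (hR : R.IsHermitian) :
    ∃ U : Matrix (Fin n) (Fin n) 𝕜, U * Uᴴ = 1 ∧ Uᴴ * U = 1 ∧
      R = U * diagonal (RCLike.ofReal ∘ hR.eigenvalues) * Uᴴ := by
  refine ⟨hR.eigenvectorUnitary, ?_, ?_, ?_⟩
  · exact Unitary.mul_star_self_of_mem hR.eigenvectorUnitary.2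
  · exact Unitary.star_mul_self_of_mem hR.eigenvectorUnitary.2
  · conv_lhs => rw [hR.spectral_theorem]
    rfl

open scoped ComplexOrder in
/-- A positive definite matrix has an inverse square root, commuting with its commutant. -/
theorem Matrix.PosDef.exists_inv_sqrt {𝕜 : Type*} [RCLike 𝕜]
    {R : Matrix (Fin n) (Fin n) 𝕜} (hR : R.PosDef) :
    ∃ M : Matrix (Fin n) (Fin n) 𝕜, Mᴴ = M ∧ M * R * M = 1 ∧
      ∀ A, A * R = R * A → A * M = M * A := by
  obtain ⟨U, h₁, h₂, hU⟩ := hR.isHermitian.exists_unitary_conj_diagonal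
  set lam : Fin n → ℝ := hR.isHermitian.eigenvalues
  have hpos : ∀ i, 0 < lam i := hR.eigenvalues_pos
  let f : 𝕜 → 𝕜 := fun z => RCLike.ofReal (√(RCLike.re z))⁻¹
  have hstar : (diagonal (f ∘ RCLike.ofReal ∘ lam))ᴴ = diagonal (f ∘ RCLike.ofReal ∘ lam) := by
    rw [diagonal_conjTranspose]
    congr 1
    ext i
    simp [f]
  refine ⟨U * diagonal (f ∘ RCLike.ofReal ∘ lam) * Uᴴ, ?_, ?_, fun A hA => ?_⟩
  · rw [conjTranspose_mul, conjTranspose_mul, conjTranspose_conjTranspose, hstar, Matrix.mul_assoc]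
  · conv_lhs => rw [hU]
    rw [conj_mul_conj h₂, conj_mul_conj h₂, diagonal_mul_diagonal, diagonal_mul_diagonal]
    have : (fun i => (f ∘ RCLike.ofReal ∘ lam) i * (RCLike.ofReal ∘ lam) i *
        (f ∘ RCLike.ofReal ∘ lam) i) = fun _ => (1 : 𝕜) := by
      ext i
      simp only [Function.comp_apply, f, RCLike.ofReal_re]
      rw [← RCLike.ofReal_mul, ← RCLike.ofReal_mul, ← RCLike.ofReal_one]
      congr 1
      have h := Real.sqrt_pos.2 (hpos i)
      have h' := Real.mul_self_sqrt (hpos i).le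
      field_simp
      nlinarith
    rw [this, diagonal_one, Matrix.mul_one, h₁]
  · rw [hU] at hA
    exact mul_conj_diagonal_comp_of_intertwines f h₂ h₁ h₂ h₁ hA

theorem Matrix.IsHermitian.isSemisimpleMat {A : Matrix (Fin n) (Fin n) ℂ} (hA : A.IsHermitian) :
    IsSemisimpleMat A := by
  obtain ⟨U, h₁, h₂, hU⟩ := hA.exists_unitary_conj_diagonal
  rw [hU]
  exact isSemisimpleMat_conj_diagonal _ h₁ h₂

/-- Normal complex matrices are diagonalizable. -/
theorem isSemisimpleMat_of_normal {A : Matrix (Fin n) (Fin n) ℂ} (hA : A * Aᴴ = Aᴴ * A) :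
    IsSemisimpleMat A := by
  let F : Bool → Matrix (Fin n) (Fin n) ℂ :=
    fun b => if b then A + Aᴴ else Complex.I • (A - Aᴴ)
  have hherm : ∀ b, (F b).IsHermitian := by
    rintro (_ | _)
    · simp [F, Matrix.IsHermitian, conjTranspose_smul, sub_eq_add_neg, add_comm]
    · simp [F, Matrix.IsHermitian, conjTranspose_add, add_comm]
  have hcomm : ∀ a b, F a * F b = F b * F a := by
    have h : (A + Aᴴ) * (A - Aᴴ) = (A - Aᴴ) * (A + Aᴴ) := by
      simp only [Matrix.add_mul, Matrix.mul_add, Matrix.sub_mul, Matrix.mul_sub, hA]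
      abel
    rintro (_ | _) (_ | _) <;> simp [F, h]
  obtain ⟨P, Pi, D, h₁, h₂, hD⟩ :=
    exists_simultaneous_conj_diagonal hcomm fun b => (hherm b).isSemisimpleMat
  have hAF : A = (1 / 2 : ℂ) • F true - (Complex.I / 2) • F false := by
    ext i j
    simp only [F, if_true, Bool.false_eq_true, if_false, Matrix.sub_apply, Matrix.smul_apply,
      Matrix.add_apply, smul_eq_mul]
    linear_combination (1 / 2 : ℂ) * (A i j - Aᴴ i j) * Complex.I_sq
  have hdiag : A = P * diagonal ((1 / 2 : ℂ) • D true - (Complex.I / 2) • D false) * Pi := by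
    conv_lhs => rw [hAF, hD true, hD false]
    have hsub : diagonal ((1 / 2 : ℂ) • D true - (Complex.I / 2) • D false) =
        (1 / 2 : ℂ) • diagonal (D true) - (Complex.I / 2) • diagonal (D false) := by
      rw [← diagonal_smul, ← diagonal_smul, diagonal_sub]
      rfl
    rw [hsub]
    simp only [Matrix.mul_sub, Matrix.sub_mul, Matrix.mul_smul, Matrix.smul_mul]
  rw [hdiag]
  exact isSemisimpleMat_conj_diagonal _ h₁ h₂

end Hermitian

section RealForm

variable {n : ℕ}

/-- Real matrices regarded as complex matrices. -/
abbrev complexify (A : Matrix (Fin n) (Fin n) ℝ) : Matrix (Fin n) (Fin n) ℂ :=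
  A.map Complex.ofReal

theorem complexify_mul (A B : Matrix (Fin n) (Fin n) ℝ) :
    complexify (A * B) = complexify A * complexify B :=
  Matrix.map_mul (f := Complex.ofRealHom)

theorem complexify_one : complexify (1 : Matrix (Fin n) (Fin n) ℝ) = 1 :=
  Matrix.map_one Complex.ofRealHom (map_zero _) (map_one _)

theorem complexify_injective :
    Function.Injective (complexify : Matrix (Fin n) (Fin n) ℝ → Matrix (Fin n) (Fin n) ℂ) :=
  Matrix.map_injective Complex.ofReal_injective

theorem conjTranspose_complexify (A : Matrix (Fin n) (Fin n) ℝ) :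
    (complexify A)ᴴ = complexify Aᵀ := by
  ext i j
  simp [complexify]

theorem det_complexify (A : Matrix (Fin n) (Fin n) ℝ) :
    (complexify A).det = (A.det : ℂ) :=
  (RingHom.map_det Complex.ofRealHom A).symm

theorem isSemisimpleMatR_of_mem_Oset {A : Matrix (Fin n) (Fin n) ℝ} (hA : A ∈ Oset n) :
    IsSemisimpleMatR A := by
  have h₁ : A * Aᵀ = 1 := (mem_orthogonalGroup_iff (Fin n) ℝ).1 hA
  have h₂ : Aᵀ * A = 1 := (mem_orthogonalGroup_iff' (Fin n) ℝ).1 hA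
  apply isSemisimpleMat_of_normal
  rw [conjTranspose_complexify, ← complexify_mul, ← complexify_mul, h₁, h₂]

/-- Tuples of real matrices that are simultaneously conjugate over `ℂ` are so over `ℝ`. -/
theorem exists_real_intertwiner {ι : Type*} {A A' : ι → Matrix (Fin n) (Fin n) ℝ}
    {G : Matrix (Fin n) (Fin n) ℂ} (hG : IsUnit G)
    (h : ∀ i, G * complexify (A i) = complexify (A' i) * G) :
    ∃ g : Matrix (Fin n) (Fin n) ℝ, IsUnit g ∧ ∀ i, g * A i = A' i * g := by
  let X : Matrix (Fin n) (Fin n) ℝ := G.map Complex.re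
  let Y : Matrix (Fin n) (Fin n) ℝ := G.map Complex.im
  have hX : ∀ i, X * A i = A' i * X := fun i => by
    ext j k
    have := congrArg Complex.re (congrFun (congrFun (h i) j) k)
    simpa [Matrix.mul_apply, X, complexify] using this
  have hY : ∀ i, Y * A i = A' i * Y := fun i => by
    ext j k
    have := congrArg Complex.im (congrFun (congrFun (h i) j) k)
    simpa [Matrix.mul_apply, Y, complexify] using this
  let p : Polynomial ℝ :=
    (X.map Polynomial.C + (Polynomial.X : Polynomial ℝ) • Y.map Polynomial.C).det
  have hp (t : ℝ) : p.eval t = (X + t • Y).det := by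
    rw [← Polynomial.coe_evalRingHom, RingHom.map_det]
    congr 1
    ext j k
    simp [mul_comm t]
  have hpI : p.aeval Complex.I = G.det := by
    rw [← AlgHom.coe_toRingHom, RingHom.map_det]
    congr 1
    ext j k
    simp [X, Y]
  have hp0 : p ≠ 0 := by
    intro h0
    rw [h0, map_zero] at hpI
    exact ((isUnit_iff_isUnit_det _).1 hG).ne_zero hpI.symm
  obtain ⟨t, ht⟩ : ∃ t, p.eval t ≠ 0 := by
    by_contra! hall
    exact hp0 (Polynomial.funext fun t => by simpa using hall t)
  refine ⟨X + t • Y, ?_, fun i => ?_⟩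
  · rw [isUnit_iff_isUnit_det, ← hp]
    exact ht.isUnit
  · rw [Matrix.add_mul, Matrix.mul_add, Matrix.smul_mul, Matrix.mul_smul, hX, hY]

end RealForm

section Characters

variable {n : ℕ} {ι : Type*}

theorem exists_perm_of_card_fiber_eq {α : Type*} [DecidableEq α] {f g : Fin n → α}
    (h : ∀ a, (Finset.univ.filter fun k => f k = a).card =
      (Finset.univ.filter fun k => g k = a).card) :
    ∃ σ : Equiv.Perm (Fin n), ∀ k, g k = f (σ k) := by
  have e (a : α) : {k // g k = a} ≃ {k // f k = a} :=
    Fintype.equivOfCardEq (by rw [Fintype.card_subtype, Fintype.card_subtype, h])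
  refine ⟨(Equiv.sigmaFiberEquiv g).symm.trans
    ((Equiv.sigmaCongrRight e).trans (Equiv.sigmaFiberEquiv f)), fun k => ?_⟩
  exact ((e (g k)) ⟨k, rfl⟩).2.symm

/-- A family of characters of a monoid is determined up to permutation by its sum. -/
theorem exists_perm_of_sum_monoidHom_eq {M : Type*} [Monoid M] {χ ψ : Fin n → (M →* ℂ)}
    (h : ∀ w, ∑ k, χ k w = ∑ k, ψ k w) : ∃ σ : Equiv.Perm (Fin n), ∀ k, ψ k = χ (σ k) := by
  classical
  have hli := linearIndependent_monoidHom M ℂ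
  have hsum : (∑ k, Finsupp.single (χ k) (1 : ℂ)) = ∑ k, Finsupp.single (ψ k) (1 : ℂ) := by
    apply hli
    ext w
    simpa [map_sum, Finsupp.linearCombination_single, Finset.sum_apply] using h w
  refine exists_perm_of_card_fiber_eq fun a => ?_
  have := DFunLike.congr_fun hsum a
  simp only [Finsupp.finsetSum_apply, Finsupp.single_apply, Finset.sum_boole] at this
  exact_mod_cast this

theorem lift_conj_diagonal {P Pi : Matrix (Fin n) (Fin n) ℂ} {D : ι → Fin n → ℂ}
    (h₁ : P * Pi = 1) (h₂ : Pi * P = 1) (w : FreeMonoid ι) :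
    FreeMonoid.lift (fun i => P * diagonal (D i) * Pi) w =
      P * diagonal (fun k => FreeMonoid.lift (fun i => D i k) w) * Pi := by
  induction w using FreeMonoid.recOn with
  | one => simp [h₁]
  | of_mul i w ih =>
    simp only [map_mul, FreeMonoid.lift_eval_of, ih]
    rw [conj_mul_conj h₂, diagonal_mul_diagonal]

theorem trace_lift_conj_diagonal {P Pi : Matrix (Fin n) (Fin n) ℂ} {D : ι → Fin n → ℂ}
    (h₁ : P * Pi = 1) (h₂ : Pi * P = 1) (w : FreeMonoid ι) :
    (FreeMonoid.lift (fun i => P * diagonal (D i) * Pi) w).trace =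
      ∑ k, FreeMonoid.lift (fun i => D i k) w := by
  rw [lift_conj_diagonal h₁ h₂, trace_mul_cycle, h₂, Matrix.one_mul, trace_diagonal]

/-- Simultaneously diagonalizable tuples with equal traces of words are simultaneously conjugate,
and have the same joint eigenvalues. -/
theorem exists_intertwiner_of_trace_lift_eq {P Pi P' Pi' : Matrix (Fin n) (Fin n) ℂ}
    {D D' : ι → Fin n → ℂ} (h₁ : P * Pi = 1) (h₂ : Pi * P = 1) (h₁' : P' * Pi' = 1)
    (h₂' : Pi' * P' = 1)
    (h : ∀ w : FreeMonoid ι, (FreeMonoid.lift (fun i => P * diagonal (D i) * Pi) w).trace =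
      (FreeMonoid.lift (fun i => P' * diagonal (D' i) * Pi') w).trace) :
    ∃ G : Matrix (Fin n) (Fin n) ℂ, IsUnit G ∧
      ∀ i, G * (P * diagonal (D i) * Pi) = P' * diagonal (D' i) * Pi' * G := by
  obtain ⟨σ, hσ⟩ := exists_perm_of_sum_monoidHom_eq
    (χ := fun k => FreeMonoid.lift fun i => D i k) (ψ := fun k => FreeMonoid.lift fun i => D' i k)
    fun w => by rw [← trace_lift_conj_diagonal h₁ h₂, ← trace_lift_conj_diagonal h₁' h₂', h]
  have hD (i : ι) (k : Fin n) : D' i k = D i (σ k) := by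
    simpa using DFunLike.congr_fun (hσ k) (FreeMonoid.of i)
  let S : Matrix (Fin n) (Fin n) ℂ := (1 : Matrix (Fin n) (Fin n) ℂ).submatrix σ id
  have hS (i : ι) : S * diagonal (D i) = diagonal (D' i) * S := by
    ext j k
    rw [mul_diagonal, diagonal_mul, hD]
    by_cases hjk : σ j = k
    · simp [S, hjk, mul_comm]
    · simp [S, hjk]
  have hSu : IsUnit S := by
    refine IsUnit.of_mul_eq_one ((1 : Matrix (Fin n) (Fin n) ℂ).submatrix id σ) ?_
    rw [← submatrix_mul _ _ σ id σ Function.bijective_id, Matrix.one_mul]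
    simp
  refine ⟨P' * S * Pi, ?_, fun i => ?_⟩
  · exact ((IsUnit.of_mul_eq_one _ h₁').mul hSu).mul (IsUnit.of_mul_eq_one _ h₂)
  · calc P' * S * Pi * (P * diagonal (D i) * Pi) = P' * S * (Pi * P) * diagonal (D i) * Pi := by
          simp only [Matrix.mul_assoc]
      _ = P' * (S * diagonal (D i)) * Pi := by rw [h₂]; simp only [Matrix.mul_assoc, Matrix.mul_one]
      _ = P' * diagonal (D' i) * (Pi' * P') * S * Pi := by
          rw [hS, h₂', Matrix.mul_one]; simp only [Matrix.mul_assoc]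
      _ = _ := by simp only [Matrix.mul_assoc]

end Characters

section UnitaryModel

variable {n : ℕ}

/-- Entrywise complex conjugation of matrices. -/
abbrev conjEntries (A : Matrix (Fin n) (Fin n) ℂ) : Matrix (Fin n) (Fin n) ℂ :=
  A.map (starRingEnd ℂ)

theorem conjEntries_mul (A B : Matrix (Fin n) (Fin n) ℂ) :
    conjEntries (A * B) = conjEntries A * conjEntries B :=
  Matrix.map_mul

theorem conjEntries_one : conjEntries (1 : Matrix (Fin n) (Fin n) ℂ) = 1 :=
  Matrix.map_one (starRingEnd ℂ) (map_zero _) (map_one _)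

theorem conjEntries_diagonal (d : Fin n → ℂ) :
    conjEntries (diagonal d) = diagonal (starRingEnd ℂ ∘ d) :=
  diagonal_map (map_zero _)

theorem conjEntries_complexify (A : Matrix (Fin n) (Fin n) ℝ) :
    conjEntries (complexify A) = complexify A := by
  ext i j
  simp

theorem complexify_map_re {A : Matrix (Fin n) (Fin n) ℂ} (hA : conjEntries A = A) :
    complexify (A.map Complex.re) = A := by
  ext i j
  exact Complex.conj_eq_iff_re.1 (congrFun (congrFun hA i) j)

/-- If a diagonalizable matrix is real, so is its image under any function commuting with
complex conjugation. -/
theorem complexify_re_conj_diagonal_comp {P Pi : Matrix (Fin n) (Fin n) ℂ} {d : Fin n → ℂ}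
    (h₁ : P * Pi = 1) (h₂ : Pi * P = 1) {f : ℂ → ℂ}
    (hf : ∀ z, f (starRingEnd ℂ z) = starRingEnd ℂ (f z))
    (hr : conjEntries (P * diagonal d * Pi) = P * diagonal d * Pi) :
    conjEntries (P * diagonal (f ∘ d) * Pi) = P * diagonal (f ∘ d) * Pi := by
  have h₁' : conjEntries P * conjEntries Pi = 1 := by
    rw [← conjEntries_mul, h₁, conjEntries_one]
  have h₂' : conjEntries Pi * conjEntries P = 1 := by
    rw [← conjEntries_mul, h₂, conjEntries_one]
  have hcomp : starRingEnd ℂ ∘ (f ∘ d) = f ∘ (starRingEnd ℂ ∘ d) := by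
    ext k
    exact (hf (d k)).symm
  rw [conjEntries_mul, conjEntries_mul, conjEntries_diagonal] at hr ⊢
  rw [hcomp]
  simpa using (mul_conj_diagonal_comp_of_intertwines (G := 1) f h₂ h₁ h₂' h₁'
    (by rw [hr, Matrix.one_mul, Matrix.mul_one])).symm

theorem col_ne_zero_of_mul_eq_one {P Pi : Matrix (Fin n) (Fin n) ℂ} (h₂ : Pi * P = 1)
    (k : Fin n) : P.col k ≠ 0 := by
  intro h
  have := congrFun (congrFun h₂ k) k
  have h' : ∀ j, P j k = 0 := fun j => congrFun h j
  simp [Matrix.mul_apply, h'] at this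

theorem norm_eigenvalue_le {A P Pi : Matrix (Fin n) (Fin n) ℂ} {d : Fin n → ℂ}
    (h₂ : Pi * P = 1) (hA : A = P * diagonal d * Pi) (k : Fin n) :
    ‖d k‖ ≤ ∑ i, ∑ j, ‖A i j‖ := by
  set x := P.col k
  have hx : 0 < ‖x‖ := norm_pos_iff.2 (col_ne_zero_of_mul_eq_one h₂ k)
  have hAx : A *ᵥ x = d k • x := mulVec_col_of_eq_conj_diagonal h₂ hA k
  refine le_of_mul_le_mul_right ?_ hx
  rw [← norm_smul, ← hAx]
  refine (pi_norm_le_iff_of_nonneg (by positivity)).2 fun i => ?_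
  calc ‖(A *ᵥ x) i‖ ≤ ∑ j, ‖A i j * x j‖ :=
        norm_sum_le Finset.univ fun j => A i j * x j
    _ ≤ ∑ j, ‖A i j‖ * ‖x‖ := by
        gcongr with j
        rw [norm_mul]
        gcongr
        exact norm_le_pi_norm x j
    _ = (∑ j, ‖A i j‖) * ‖x‖ := (Finset.sum_mul _ _ _).symm
    _ ≤ (∑ i, ∑ j, ‖A i j‖) * ‖x‖ := by
        exact mul_le_mul_of_nonneg_right (Finset.single_le_sum (f := fun i => ∑ j, ‖A i j‖)
          (fun _ _ => Finset.sum_nonneg fun _ _ => norm_nonneg _) (Finset.mem_univ i))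
          (norm_nonneg _)

open scoped ComplexOrder in
theorem norm_eigenvalue_of_unitary {A P Pi : Matrix (Fin n) (Fin n) ℂ} {d : Fin n → ℂ}
    (h₂ : Pi * P = 1) (hA : A = P * diagonal d * Pi) (hu : Aᴴ * A = 1) (k : Fin n) :
    ‖d k‖ = 1 := by
  set x := P.col k
  have hx : star x ⬝ᵥ x ≠ 0 := by
    rw [Ne, dotProduct_star_self_eq_zero]
    exact col_ne_zero_of_mul_eq_one h₂ k
  have hAx : A *ᵥ x = d k • x := mulVec_col_of_eq_conj_diagonal h₂ hA k
  have h : star (d k) * d k * (star x ⬝ᵥ x) = star x ⬝ᵥ x := by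
    calc star (d k) * d k * (star x ⬝ᵥ x) = star (A *ᵥ x) ⬝ᵥ (A *ᵥ x) := by
          rw [hAx, star_smul, smul_dotProduct, dotProduct_smul, smul_eq_mul, smul_eq_mul, mul_assoc]
      _ = star x ⬝ᵥ ((Aᴴ * A) *ᵥ x) := by
          rw [star_mulVec, ← mulVec_mulVec, dotProduct_mulVec (star x)]
      _ = _ := by rw [hu, one_mulVec]
  have h' : star (d k) * d k = 1 := mul_right_cancel₀ hx (by rw [h, one_mul])
  have h'' : ‖d k‖ * ‖d k‖ = 1 := by
    simpa using congrArg norm h'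
  nlinarith [norm_nonneg (d k)]

open scoped ComplexOrder in
theorem posDef_of_complexify {A : Matrix (Fin n) (Fin n) ℝ} (hA : (complexify A).PosDef) :
    A.PosDef := by
  refine PosDef.of_dotProduct_mulVec_pos ?_ fun x hx => ?_
  · apply complexify_injective
    rw [conjTranspose_eq_transpose_of_trivial, ← conjTranspose_complexify]
    exact hA.isHermitian
  · have hx' : (fun i => (x i : ℂ)) ≠ 0 := fun h => hx (by
      ext i
      exact Complex.ofReal_injective (congrFun h i))
    have := hA.dotProduct_mulVec_pos hx'
    have hcast : star (fun i => (x i : ℂ)) ⬝ᵥ (complexify A *ᵥ fun i => (x i : ℂ)) =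
        ((star x ⬝ᵥ (A *ᵥ x) : ℝ) : ℂ) := by
      simp [dotProduct, mulVec, complexify]
    rw [hcast] at this
    exact_mod_cast this

open scoped ComplexOrder in
/-- Every commuting tuple of semisimple real matrices is simultaneously conjugate, over `ℝ`, to a
tuple that is simultaneously unitarily diagonalizable over `ℂ`. -/
theorem exists_conj_unitarily_diagonal {ι : Type*} {a : ι → Matrix (Fin n) (Fin n) ℝ}
    (hc : ∀ i j, a i * a j = a j * a i) (hs : ∀ i, IsSemisimpleMatR (a i)) :
    ∃ (g gi : Matrix (Fin n) (Fin n) ℝ) (P : Matrix (Fin n) (Fin n) ℂ) (D : ι → Fin n → ℂ),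
      g * gi = 1 ∧ gi * g = 1 ∧ P * Pᴴ = 1 ∧ Pᴴ * P = 1 ∧
      ∀ i, complexify (g * a i * gi) = P * diagonal (D i) * Pᴴ := by
  obtain ⟨P₀, Pi₀, D, h₁, h₂, hD⟩ := exists_simultaneous_conj_diagonal
    (A := fun i => complexify (a i))
    (fun i j => by rw [← complexify_mul, hc, complexify_mul]) hs
  have h₁' : conjEntries P₀ * conjEntries Pi₀ = 1 := by
    rw [← conjEntries_mul, h₁, conjEntries_one]
  have h₂' : conjEntries Pi₀ * conjEntries P₀ = 1 := by
    rw [← conjEntries_mul, h₂, conjEntries_one]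
  let Z := conjEntries Pi₀ * P₀
  have hZ (i : ι) : Z * diagonal (D i) = diagonal (starRingEnd ℂ ∘ D i) * Z := by
    have hcD : complexify (a i) =
        conjEntries P₀ * diagonal (starRingEnd ℂ ∘ D i) * conjEntries Pi₀ := by
      rw [← conjEntries_complexify, hD i, conjEntries_mul, conjEntries_mul, conjEntries_diagonal]
    calc Z * diagonal (D i) = conjEntries Pi₀ * (P₀ * diagonal (D i) * Pi₀) * P₀ := by
          simp only [Z, Matrix.mul_assoc, h₂, Matrix.mul_one]
      _ = (conjEntries Pi₀ * conjEntries P₀) * diagonal (starRingEnd ℂ ∘ D i) * Z := by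
          rw [← hD i, hcD]; simp only [Z, Matrix.mul_assoc]
      _ = _ := by rw [h₂', Matrix.one_mul]
  have hZstar (i : ι) : Zᴴ * diagonal (starRingEnd ℂ ∘ D i) = diagonal (D i) * Zᴴ := by
    have hbar := mul_diagonal_comp_of_intertwines (starRingEnd ℂ) (hZ i)
    have hstar : starRingEnd ℂ ∘ (starRingEnd ℂ ∘ D i) = D i := by
      ext k
      simp
    have hstar' : star (starRingEnd ℂ ∘ D i) = D i := hstar
    have hstar'' : star (D i) = starRingEnd ℂ ∘ D i := rfl
    rw [hstar] at hbar
    have := congrArg conjTranspose hbar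
    rw [conjTranspose_mul Z, conjTranspose_mul _ Z, diagonal_conjTranspose,
      diagonal_conjTranspose, hstar', hstar''] at this
    exact this.symm
  let Q := Pi₀ᴴ * Pi₀ + (conjEntries Pi₀)ᴴ * conjEntries Pi₀
  have hinj {A B : Matrix (Fin n) (Fin n) ℂ} (h : A * B = 1) :
      Function.Injective (B *ᵥ ·) := by
    intro v w hvw
    have := congrArg (A *ᵥ ·) hvw
    simpa [mulVec_mulVec, h] using this
  have hQ : Q.PosDef :=
    (PosDef.conjTranspose_mul_self _ (hinj h₁)).add (PosDef.conjTranspose_mul_self _ (hinj h₁'))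
  have hQconj : conjEntries Q = Q := by
    ext i j
    simp [Q, Matrix.mul_apply, add_comm]
  let S : Matrix (Fin n) (Fin n) ℝ := Q.map Complex.re
  have hSQ : complexify S = Q := complexify_map_re hQconj
  have hS : S.PosDef := posDef_of_complexify (by rwa [hSQ])
  obtain ⟨N, hN, hNSN, hNcomm⟩ := hS.exists_inv_sqrt
  have hgN : N * S * N = 1 := hNSN
  have hNg : N * (N * S) = 1 := mul_eq_one_comm.1 hgN
  have hgg : (N * S)ᵀ * (N * S) = S := by
    have hN' : Nᵀ = N := by rwa [conjTranspose_eq_transpose_of_trivial] at hN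
    have hS' : Sᵀ = S := by
      have := hS.isHermitian
      rwa [Matrix.IsHermitian, conjTranspose_eq_transpose_of_trivial] at this
    rw [transpose_mul, hN', hS', Matrix.mul_assoc, hNg, Matrix.mul_one]
  have hR : (P₀ᴴ * Q * P₀).PosDef := hQ.conjTranspose_mul_mul_same (hinj h₂)
  obtain ⟨M, hM, hMRM, hMcomm⟩ := hR.exists_inv_sqrt
  have hRZ : P₀ᴴ * Q * P₀ = 1 + Zᴴ * Z := by
    have : P₀ᴴ * Pi₀ᴴ = 1 := by rw [← conjTranspose_mul, h₂, conjTranspose_one]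
    calc P₀ᴴ * Q * P₀ = (P₀ᴴ * Pi₀ᴴ) * (Pi₀ * P₀) + Zᴴ * Z := by
          simp only [Q, Z, Matrix.mul_add, Matrix.add_mul, conjTranspose_mul, Matrix.mul_assoc]
      _ = _ := by rw [this, h₂, Matrix.one_mul]
  have hMD (i : ι) : diagonal (D i) * M = M * diagonal (D i) := by
    apply hMcomm
    rw [hRZ, Matrix.mul_add, Matrix.add_mul, Matrix.mul_one, Matrix.one_mul]
    congr 1
    calc diagonal (D i) * (Zᴴ * Z) = (diagonal (D i) * Zᴴ) * Z := (Matrix.mul_assoc _ _ _).symm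
      _ = Zᴴ * (diagonal (starRingEnd ℂ ∘ D i) * Z) := by rw [← hZstar, Matrix.mul_assoc]
      _ = Zᴴ * Z * diagonal (D i) := by rw [← hZ i, Matrix.mul_assoc Zᴴ]
  let P := complexify (N * S) * P₀ * M
  have hPP : Pᴴ * P = 1 := by
    calc Pᴴ * P = M * (P₀ᴴ * ((complexify (N * S))ᴴ * complexify (N * S)) * P₀) * M := by
          simp only [P, conjTranspose_mul, hM, Matrix.mul_assoc]
      _ = 1 := by rw [conjTranspose_complexify, ← complexify_mul, hgg, hSQ, hMRM]
  refine ⟨N * S, N, P, D, hgN, hNg, mul_eq_one_comm.1 hPP, hPP, fun i => ?_⟩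
  have key : complexify (N * S * a i * N) * P = P * diagonal (D i) := by
    calc complexify (N * S * a i * N) * P
        = complexify (N * S) * complexify (a i) * complexify (N * (N * S)) * P₀ * M := by
          simp only [P, complexify_mul, Matrix.mul_assoc]
      _ = complexify (N * S) * P₀ * diagonal (D i) * (Pi₀ * P₀) * M := by
          rw [hNg, complexify_one, Matrix.mul_one, hD i]; simp only [Matrix.mul_assoc]
      _ = complexify (N * S) * P₀ * (diagonal (D i) * M) := by
          rw [h₂, Matrix.mul_one]; simp only [Matrix.mul_assoc]
      _ = P * diagonal (D i) := by rw [hMD]; simp only [P, Matrix.mul_assoc]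
  rw [← key, Matrix.mul_assoc _ P, mul_eq_one_comm.1 hPP, Matrix.mul_one]

/-- Simultaneously conjugate tuples of orthogonal matrices are conjugate by an orthogonal matrix. -/
theorem exists_orthogonal_intertwiner {ι : Type*} {k k' : ι → Matrix (Fin n) (Fin n) ℝ}
    (hk : ∀ i, k i ∈ Oset n) (hk' : ∀ i, k' i ∈ Oset n) {g : Matrix (Fin n) (Fin n) ℝ}
    (hg : IsUnit g) (h : ∀ i, g * k i = k' i * g) :
    ∃ u : Matrix (Fin n) (Fin n) ℝ, uᵀ * u = 1 ∧ ∀ i, u * k i = k' i * u := by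
  have hR : (gᵀ * g).PosDef := by
    rw [← conjTranspose_eq_transpose_of_trivial]
    exact PosDef.conjTranspose_mul_self _ (mulVec_injective_iff_isUnit.2 hg)
  have hcomm (i : ι) : k i * (gᵀ * g) = gᵀ * g * k i := by
    have h₁ : k i * (k i)ᵀ = 1 := (mem_orthogonalGroup_iff (Fin n) ℝ).1 (hk i)
    have h₂ : (k' i)ᵀ * k' i = 1 := (mem_orthogonalGroup_iff' (Fin n) ℝ).1 (hk' i)
    have ht : (k i)ᵀ * gᵀ = gᵀ * (k' i)ᵀ := by
      rw [← transpose_mul, ← transpose_mul, h i]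
    calc k i * (gᵀ * g) = k i * gᵀ * ((k' i)ᵀ * k' i) * g := by
          rw [h₂, Matrix.mul_one, Matrix.mul_assoc]
      _ = k i * (gᵀ * (k' i)ᵀ) * (k' i * g) := by simp only [Matrix.mul_assoc]
      _ = (k i * (k i)ᵀ) * gᵀ * (g * k i) := by rw [← ht, ← h i]; simp only [Matrix.mul_assoc]
      _ = _ := by rw [h₁, Matrix.one_mul, Matrix.mul_assoc]
  obtain ⟨M, hM, hMRM, hMcomm⟩ := hR.exists_inv_sqrt
  rw [conjTranspose_eq_transpose_of_trivial] at hM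
  refine ⟨g * M, ?_, fun i => ?_⟩
  · rw [transpose_mul, hM, ← hMRM]
    simp only [Matrix.mul_assoc]
  · rw [Matrix.mul_assoc, ← hMcomm _ (hcomm i), ← Matrix.mul_assoc, h i, Matrix.mul_assoc]

end UnitaryModel

section RepresentationSpace

variable {m n : ℕ}

theorem conjRel_GLRset_iff {S : Set (Fin m → Matrix (Fin n) (Fin n) ℝ)} (x y : S) :
    conjRel (GLRset n) S x y ↔ ∃ g : Matrix (Fin n) (Fin n) ℝ, IsUnit g ∧
      ∀ i, g * (x : Fin m → Matrix (Fin n) (Fin n) ℝ) i =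
        (y : Fin m → Matrix (Fin n) (Fin n) ℝ) i * g := by
  constructor
  · rintro ⟨g, gi, hg, -, -, h₂, h⟩
    refine ⟨g, hg, fun i => ?_⟩
    rw [← h i, Matrix.mul_assoc, h₂, Matrix.mul_one]
  · rintro ⟨g, hg, h⟩
    obtain ⟨u, rfl⟩ := hg
    refine ⟨u, (u⁻¹ : (Matrix (Fin n) (Fin n) ℝ)ˣ), u.isUnit, u⁻¹.isUnit, u.mul_inv, u.inv_mul,
      fun i => ?_⟩
    rw [h i, Matrix.mul_assoc, u.mul_inv, Matrix.mul_one]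

theorem conjRel_GLRset_equivalence (S : Set (Fin m → Matrix (Fin n) (Fin n) ℝ)) :
    Equivalence (conjRel (GLRset n) S) where
  refl x := (conjRel_GLRset_iff x x).2 ⟨1, isUnit_one, fun i => by simp⟩
  symm := by
    rintro x y ⟨g, gi, hg, hgi, h₁, h₂, h⟩
    refine ⟨gi, g, hgi, hg, h₂, h₁, fun i => ?_⟩
    calc gi * (y : Fin m → Matrix (Fin n) (Fin n) ℝ) i * g
        = (gi * g) * (x : Fin m → Matrix (Fin n) (Fin n) ℝ) i * (gi * g) := by
          rw [← h i]; simp only [Matrix.mul_assoc]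
      _ = _ := by rw [h₂, Matrix.one_mul, Matrix.mul_one]
  trans := by
    intro x y z hxy hyz
    obtain ⟨g, hg, h⟩ := (conjRel_GLRset_iff x y).1 hxy
    obtain ⟨g', hg', h'⟩ := (conjRel_GLRset_iff y z).1 hyz
    refine (conjRel_GLRset_iff x z).2 ⟨g' * g, hg'.mul hg, fun i => ?_⟩
    rw [Matrix.mul_assoc, h i, ← Matrix.mul_assoc, h' i, Matrix.mul_assoc]

theorem repSpace_mk_eq_iff {S : Set (Fin m → Matrix (Fin n) (Fin n) ℝ)} {x y : S} :
    (Quot.mk _ x : RepSpace (GLRset n) S) = Quot.mk _ y ↔ conjRel (GLRset n) S x y := by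
  rw [Quot.eq, (conjRel_GLRset_equivalence S).eqvGen_iff]

/-- The sum of the absolute values of the entries of a matrix. -/
noncomputable def entrySum (A : Matrix (Fin n) (Fin n) ℝ) : ℝ := ∑ i, ∑ j, ‖complexify A i j‖

theorem continuous_entrySum : Continuous (entrySum : Matrix (Fin n) (Fin n) ℝ → ℝ) := by
  unfold entrySum
  simp only [Matrix.map_apply]
  fun_prop

/-- Classes having a representative all of whose entry sums are less than `r`. -/
def boundedClasses (m n : ℕ) (r : ℝ) : Set (RepSpace (GLRset n) (ssTuplesR m n)) :=
  {x | ∃ a : ssTuplesR m n, Quot.mk _ a = x ∧ ∃ g gi : Matrix (Fin n) (Fin n) ℝ,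
    g * gi = 1 ∧ gi * g = 1 ∧ ∀ i, entrySum (g * a.1 i * gi) < r}

theorem mk_mem_boundedClasses_iff {r : ℝ} {a : ssTuplesR m n} :
    (Quot.mk _ a : RepSpace (GLRset n) (ssTuplesR m n)) ∈ boundedClasses m n r ↔
      ∃ g gi : Matrix (Fin n) (Fin n) ℝ,
        g * gi = 1 ∧ gi * g = 1 ∧ ∀ i, entrySum (g * a.1 i * gi) < r := by
  refine ⟨?_, fun h => ⟨a, rfl, h⟩⟩
  rintro ⟨b, hb, g, gi, h₁, h₂, h⟩
  obtain ⟨k, ki, -, -, h₁', h₂', h'⟩ := repSpace_mk_eq_iff.1 hb.symm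
  refine ⟨g * k, ki * gi, ?_, ?_, fun i => ?_⟩
  · rw [Matrix.mul_assoc, ← Matrix.mul_assoc k, h₁', Matrix.one_mul, h₁]
  · rw [Matrix.mul_assoc, ← Matrix.mul_assoc gi, h₂, Matrix.one_mul, h₂']
  · have hi := h i
    rw [← h' i] at hi
    simpa only [Matrix.mul_assoc] using hi

theorem isOpen_boundedClasses (r : ℝ) : IsOpen (boundedClasses m n r) := by
  refine isOpen_coinduced.2 ?_
  have : Quot.mk _ ⁻¹' boundedClasses m n r = ⋃ (g : Matrix (Fin n) (Fin n) ℝ),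
      ⋃ (gi : Matrix (Fin n) (Fin n) ℝ), ⋃ (_ : g * gi = 1 ∧ gi * g = 1), ⋂ i,
        {a : ssTuplesR m n | entrySum (g * a.1 i * gi) < r} := by
    ext a
    simp only [Set.mem_preimage, mk_mem_boundedClasses_iff, Set.mem_iUnion, Set.mem_iInter,
      Set.mem_ofPred_eq, exists_prop, and_assoc]
  rw [this]
  refine isOpen_iUnion fun g => isOpen_iUnion fun gi => isOpen_iUnion fun _ =>
    isOpen_iInter_of_finite fun i => ?_
  refine isOpen_lt (continuous_entrySum.comp ?_) continuous_const
  exact (continuous_const.matrix_mul ((continuous_apply i).comp continuous_subtype_val)).matrix_mul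
    continuous_const

theorem mul_lift_of_intertwines {ι : Type*} {A A' : ι → Matrix (Fin n) (Fin n) ℂ}
    {G : Matrix (Fin n) (Fin n) ℂ} (h : ∀ i, G * A i = A' i * G) (w : FreeMonoid ι) :
    G * FreeMonoid.lift A w = FreeMonoid.lift A' w * G := by
  induction w using FreeMonoid.recOn with
  | one => simp
  | of_mul i w ih =>
    simp only [map_mul, FreeMonoid.lift_eval_of]
    rw [← Matrix.mul_assoc, h, Matrix.mul_assoc, ih, Matrix.mul_assoc]

theorem trace_lift_eq_of_intertwines {ι : Type*} {A A' : ι → Matrix (Fin n) (Fin n) ℂ}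
    {G : Matrix (Fin n) (Fin n) ℂ} (hG : IsUnit G) (h : ∀ i, G * A i = A' i * G)
    (w : FreeMonoid ι) : (FreeMonoid.lift A w).trace = (FreeMonoid.lift A' w).trace := by
  obtain ⟨u, rfl⟩ := hG
  have : FreeMonoid.lift A' w = u * FreeMonoid.lift A w * (u⁻¹ : (Matrix (Fin n) (Fin n) ℂ)ˣ) := by
    rw [mul_lift_of_intertwines h, Matrix.mul_assoc, u.mul_inv, Matrix.mul_one]
  rw [this, trace_mul_cycle, u.inv_mul, Matrix.one_mul]

theorem continuous_lift {ι : Type*} (w : FreeMonoid ι) :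
    Continuous fun A : ι → Matrix (Fin n) (Fin n) ℂ => FreeMonoid.lift A w := by
  induction w using FreeMonoid.recOn with
  | one => simpa using continuous_const
  | of_mul i w ih =>
    simp only [map_mul, FreeMonoid.lift_eval_of]
    exact (continuous_apply i).matrix_mul ih

theorem continuous_complexify :
    Continuous (complexify : Matrix (Fin n) (Fin n) ℝ → Matrix (Fin n) (Fin n) ℂ) :=
  continuous_id.matrix_map Complex.continuous_ofReal

theorem isUnit_complexify {g : Matrix (Fin n) (Fin n) ℝ} (hg : IsUnit g) :
    IsUnit (complexify g) := by
  rw [isUnit_iff_isUnit_det, det_complexify]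
  exact ((isUnit_iff_isUnit_det g).1 hg).map Complex.ofRealHom

/-- The trace of a word in a tuple, as a function on the representation space. -/
def traceWord (w : FreeMonoid (Fin m)) : RepSpace (GLRset n) (ssTuplesR m n) → ℂ :=
  Quot.lift (fun a => (FreeMonoid.lift (fun i => complexify (a.1 i)) w).trace) fun a b hab => by
    obtain ⟨g, hg, h⟩ := (conjRel_GLRset_iff a b).1 hab
    exact trace_lift_eq_of_intertwines (isUnit_complexify hg)
      (fun i => by rw [← complexify_mul, h i, complexify_mul]) w

theorem continuous_traceWord (w : FreeMonoid (Fin m)) :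
    Continuous (traceWord w : RepSpace (GLRset n) (ssTuplesR m n) → ℂ) := by
  refine continuous_quot_lift _ (Continuous.matrix_trace ((continuous_lift w).comp ?_))
  exact continuous_pi fun i =>
    continuous_complexify.comp ((continuous_apply i).comp continuous_subtype_val)

end RepresentationSpace

section NormalModel

variable {m n : ℕ}

/-- The commuting tuple of matrices with eigenbasis `p.1` and joint eigenvalues `p.2`. -/
def modelTuple (p : Matrix (Fin n) (Fin n) ℂ × (Fin m → Fin n → ℂ)) (i : Fin m) :
    Matrix (Fin n) (Fin n) ℂ :=
  p.1 * diagonal (p.2 i) * p.1ᴴ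

/-- Pairs of a unitary eigenbasis and nonzero joint eigenvalues defining real matrices. -/
def normalModel (m n : ℕ) : Set (Matrix (Fin n) (Fin n) ℂ × (Fin m → Fin n → ℂ)) :=
  {p | p.1 * p.1ᴴ = 1 ∧ p.1ᴴ * p.1 = 1 ∧ (∀ i k, p.2 i k ≠ 0) ∧
    ∀ i, conjEntries (modelTuple p i) = modelTuple p i}

/-- The real part of the tuple defined by an eigenbasis and joint eigenvalues. -/
def realTuple (p : Matrix (Fin n) (Fin n) ℂ × (Fin m → Fin n → ℂ)) (i : Fin m) :
    Matrix (Fin n) (Fin n) ℝ :=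
  (modelTuple p i).map Complex.re

theorem complexify_realTuple {p : Matrix (Fin n) (Fin n) ℂ × (Fin m → Fin n → ℂ)}
    (hp : p ∈ normalModel m n) (i : Fin m) : complexify (realTuple p i) = modelTuple p i :=
  complexify_map_re (hp.2.2.2 i)

theorem continuous_modelTuple :
    Continuous (modelTuple : _ → Fin m → Matrix (Fin n) (Fin n) ℂ) := by
  refine continuous_pi fun i => ?_
  have hD : Continuous fun p : Matrix (Fin n) (Fin n) ℂ × (Fin m → Fin n → ℂ) =>
      diagonal (p.2 i) := Continuous.matrix_diagonal ((continuous_apply i).comp continuous_snd)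
  exact (continuous_fst.matrix_mul hD).matrix_mul continuous_fst.matrix_conjTranspose

theorem isUnit_of_isUnit_complexify {g : Matrix (Fin n) (Fin n) ℝ} (hg : IsUnit (complexify g)) :
    IsUnit g := by
  rw [isUnit_iff_isUnit_det, det_complexify] at hg
  rw [isUnit_iff_isUnit_det]
  exact (isUnit_map_iff Complex.ofRealHom _).1 hg

theorem isUnit_modelTuple_iff {p : Matrix (Fin n) (Fin n) ℂ × (Fin m → Fin n → ℂ)}
    (h₁ : p.1 * p.1ᴴ = 1) (i : Fin m) :
    IsUnit (modelTuple p i) ↔ ∀ k, p.2 i k ≠ 0 := by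
  have hu : IsUnit p.1 := IsUnit.of_mul_eq_one _ h₁
  rw [isUnit_iff_isUnit_det] at hu ⊢
  rw [modelTuple, det_mul, det_mul, det_diagonal, isUnit_iff_ne_zero]
  simp [hu.ne_zero, Finset.prod_eq_zero_iff]

theorem realTuple_mem {p : Matrix (Fin n) (Fin n) ℂ × (Fin m → Fin n → ℂ)}
    (hp : p ∈ normalModel m n) : realTuple p ∈ ssTuplesR m n := by
  refine ⟨⟨fun i => isUnit_of_isUnit_complexify ?_, fun i j => complexify_injective ?_⟩,
    fun i => ?_⟩
  · rw [complexify_realTuple hp]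
    exact (isUnit_modelTuple_iff hp.1 i).2 (hp.2.2.1 i)
  · rw [complexify_mul, complexify_mul, complexify_realTuple hp, complexify_realTuple hp,
      modelTuple, modelTuple, conj_mul_conj hp.2.1, conj_mul_conj hp.2.1, diagonal_mul_diagonal,
      diagonal_mul_diagonal]
    simp only [mul_comm]
  · change IsSemisimpleMat (complexify (realTuple p i))
    rw [complexify_realTuple hp]
    exact isSemisimpleMat_conj_diagonal _ hp.1 hp.2.1

/-- The conjugacy class of the tuple defined by a point of the model. -/
def modelClass (p : normalModel m n) : RepSpace (GLRset n) (ssTuplesR m n) :=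
  Quot.mk _ ⟨realTuple p.1, realTuple_mem p.2⟩

theorem continuous_modelClass :
    Continuous (modelClass : normalModel m n → RepSpace (GLRset n) (ssTuplesR m n)) := by
  refine continuous_quot_mk.comp (Continuous.subtype_mk (continuous_pi fun i => ?_) _)
  exact Continuous.matrix_map
    ((continuous_apply i).comp (continuous_modelTuple.comp continuous_subtype_val))
    Complex.continuous_re

theorem exists_modelClass_eq (a : ssTuplesR m n) :
    ∃ (p : normalModel m n) (g gi : Matrix (Fin n) (Fin n) ℝ), g * gi = 1 ∧ gi * g = 1 ∧
      (∀ i, g * a.1 i * gi = realTuple p.1 i) ∧ modelClass p = Quot.mk _ a := by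
  obtain ⟨g, gi, P, D, h₁, h₂, hP₁, hP₂, hD⟩ := exists_conj_unitarily_diagonal a.2.1.2 a.2.2
  have hg : IsUnit g := IsUnit.of_mul_eq_one _ h₁
  have hgi : IsUnit gi := IsUnit.of_mul_eq_one _ h₂
  have hp : (P, D) ∈ normalModel m n := by
    refine ⟨hP₁, hP₂, fun i => ?_, fun i => ?_⟩
    · refine (isUnit_modelTuple_iff (p := (P, D)) hP₁ i).1 ?_
      rw [modelTuple, ← hD i]
      exact isUnit_complexify ((hg.mul (a.2.1.1 i)).mul hgi)
    · rw [modelTuple, ← hD i, conjEntries_complexify]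
  have h (i : Fin m) : g * a.1 i * gi = realTuple (P, D) i := by
    apply complexify_injective
    rw [hD i, complexify_realTuple hp, modelTuple]
  exact ⟨⟨_, hp⟩, g, gi, h₁, h₂, h, (Quot.sound ⟨g, gi, hg, hgi, h₁, h₂, h⟩).symm⟩

theorem modelClass_surjective :
    Function.Surjective (modelClass : normalModel m n → RepSpace (GLRset n) (ssTuplesR m n)) := by
  rintro ⟨a⟩
  obtain ⟨p, -, -, -, -, -, h⟩ := exists_modelClass_eq a
  exact ⟨p, h⟩

theorem traceWord_modelClass (w : FreeMonoid (Fin m)) (p : normalModel m n) :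
    traceWord w (modelClass p) = (FreeMonoid.lift (modelTuple p.1) w).trace := by
  change (FreeMonoid.lift (fun i => complexify (realTuple p.1 i)) w).trace = _
  simp only [complexify_realTuple p.2]

theorem norm_eigenvalue_lt_of_mem_boundedClasses {r : ℝ} {p : normalModel m n}
    (hp : modelClass p ∈ boundedClasses m n r) (i : Fin m) (k : Fin n) : ‖p.1.2 i k‖ < r := by
  obtain ⟨g, gi, h₁, h₂, h⟩ := mk_mem_boundedClasses_iff.1 hp
  refine lt_of_le_of_lt (norm_eigenvalue_le (P := complexify g * p.1.1)
    (Pi := p.1.1ᴴ * complexify gi) ?_ ?_ k) (h i)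
  · calc p.1.1ᴴ * complexify gi * (complexify g * p.1.1)
        = p.1.1ᴴ * (complexify (gi * g)) * p.1.1 := by
          rw [complexify_mul]; simp only [Matrix.mul_assoc]
      _ = 1 := by rw [h₂, complexify_one, Matrix.mul_one, p.2.2.1]
  · rw [complexify_mul, complexify_mul, complexify_realTuple p.2, modelTuple]
    simp only [Matrix.mul_assoc]

/-- Taking the conjugacy class of a point of the model is a proper map. -/
theorem isProperMap_modelClass :
    IsProperMap (modelClass : normalModel m n → RepSpace (GLRset n) (ssTuplesR m n)) := by
  refine isProperMap_iff_ultrafilter.2 ⟨continuous_modelClass, fun U x hU => ?_⟩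
  obtain ⟨a, rfl⟩ := Quot.exists_rep x
  let r : ℝ := (∑ i, entrySum (a.1 i)) + 1
  have ha : (Quot.mk _ a : RepSpace (GLRset n) (ssTuplesR m n)) ∈ boundedClasses m n r := by
    refine mk_mem_boundedClasses_iff.2 ⟨1, 1, Matrix.one_mul _, Matrix.one_mul _, fun i => ?_⟩
    rw [Matrix.one_mul, Matrix.mul_one]
    have : entrySum (a.1 i) ≤ ∑ i, entrySum (a.1 i) :=
      Finset.single_le_sum (f := fun i => entrySum (a.1 i)) (fun _ _ =>
        Finset.sum_nonneg fun _ _ => Finset.sum_nonneg fun _ _ => norm_nonneg _)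
        (Finset.mem_univ i)
    exact this.trans_lt (lt_add_one _)
  let K : Set (Matrix (Fin n) (Fin n) ℂ × (Fin m → Fin n → ℂ)) :=
    (Set.univ.pi fun _ => Set.univ.pi fun _ => Metric.closedBall (0 : ℂ) 1) ×ˢ
      (Set.univ.pi fun _ => Set.univ.pi fun _ => Metric.closedBall (0 : ℂ) r)
  have hK : IsCompact K :=
    (isCompact_univ_pi fun _ => isCompact_univ_pi fun _ => isCompact_closedBall _ _).prod
      (isCompact_univ_pi fun _ => isCompact_univ_pi fun _ => isCompact_closedBall _ _)
  have hUK : K ∈ U.map Subtype.val := by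
    rw [Ultrafilter.mem_map]
    filter_upwards [hU ((isOpen_boundedClasses r).mem_nhds ha)] with p hp
    refine ⟨fun i _ j _ => ?_, fun i _ k _ => ?_⟩
    · rw [mem_closedBall_zero_iff]
      exact entry_norm_bound_of_unitary ((mem_unitaryGroup_iff).2 p.2.1) i j
    · rw [mem_closedBall_zero_iff]
      exact (norm_eigenvalue_lt_of_mem_boundedClasses hp i k).le
  obtain ⟨q, -, hq⟩ := hK.ultrafilter_le_nhds' _ hUK
  have hlim : Filter.Tendsto (Subtype.val : normalModel m n → _) U (nhds q) := hq
  have hclosed {C : Set (Matrix (Fin n) (Fin n) ℂ × (Fin m → Fin n → ℂ))} (hC : IsClosed C)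
      (h : ∀ p ∈ normalModel m n, p ∈ C) : q ∈ C :=
    hC.mem_of_tendsto hlim (Filter.Eventually.of_forall fun p => h p.1 p.2)
  have hq₁ : q.1 * q.1ᴴ = 1 := hclosed (C := {p | p.1 * p.1ᴴ = 1})
    (isClosed_eq (continuous_fst.matrix_mul continuous_fst.matrix_conjTranspose) continuous_const)
    fun p hp => hp.1
  have hq₂ : q.1ᴴ * q.1 = 1 := mul_eq_one_comm.1 hq₁
  have hq₃ (i : Fin m) : conjEntries (modelTuple q i) = modelTuple q i :=
    hclosed (C := {p | conjEntries (modelTuple p i) = modelTuple p i})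
      (isClosed_eq (((continuous_apply i).comp continuous_modelTuple).matrix_map
        Complex.continuous_conj) ((continuous_apply i).comp continuous_modelTuple))
      fun p hp => hp.2.2.2 i
  have htrace (w : FreeMonoid (Fin m)) : (FreeMonoid.lift (modelTuple q) w).trace =
      (FreeMonoid.lift (fun i => complexify (a.1 i)) w).trace := by
    have h₁ : Filter.Tendsto (fun p : normalModel m n => (FreeMonoid.lift (modelTuple p.1) w).trace)
        U (nhds (FreeMonoid.lift (modelTuple q) w).trace) :=
      (((continuous_lift w).comp continuous_modelTuple).matrix_trace.tendsto q).comp hlim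
    have h₂ := ((continuous_traceWord w).tendsto _).comp hU
    refine tendsto_nhds_unique h₁ (h₂.congr fun p => ?_)
    exact traceWord_modelClass w p
  obtain ⟨P, Pi, D, hP₁, hP₂, hD⟩ := exists_simultaneous_conj_diagonal
    (A := fun i => complexify (a.1 i))
    (fun i j => by rw [← complexify_mul, a.2.1.2, complexify_mul]) a.2.2
  obtain ⟨G, hG, hGq⟩ := exists_intertwiner_of_trace_lift_eq hq₁ hq₂ hP₁ hP₂ (D := q.2) (D' := D)
    fun w => by
      have := htrace w
      simp only [hD] at this
      exact this
  have hGa (i : Fin m) : G * modelTuple q i = complexify (a.1 i) * G := by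
    rw [hD i]
    exact hGq i
  have hq₀ (i : Fin m) : ∀ k, q.2 i k ≠ 0 := by
    refine (isUnit_modelTuple_iff hq₁ i).1 ?_
    have h : IsUnit (G * modelTuple q i) := by
      rw [hGa i]
      exact (isUnit_complexify (a.2.1.1 i)).mul hG
    exact isUnit_of_mul_isUnit_right h
  have hqE : q ∈ normalModel m n := ⟨hq₁, hq₂, hq₀, hq₃⟩
  refine ⟨⟨q, hqE⟩, ?_, ?_⟩
  · obtain ⟨g, hg, h⟩ := exists_real_intertwiner (A := realTuple q) (A' := a.1) hG
      fun i => by rw [complexify_realTuple hqE, hGa i]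
    exact Quot.sound ((conjRel_GLRset_iff _ _).2 ⟨g, hg, h⟩)
  · rw [nhds_subtype_eq_comap]
    exact Filter.map_le_iff_le_comap.1 hq

end NormalModel

section RadialFlow

variable {m n : ℕ}

/-- The radial deformation of the punctured plane onto the unit circle. -/
noncomputable def radialFlow (t : ℝ) (z : ℂ) : ℂ := ((1 - t + t * ‖z‖⁻¹ : ℝ) : ℂ) * z

theorem radialFlow_conj (t : ℝ) (z : ℂ) :
    radialFlow t (starRingEnd ℂ z) = starRingEnd ℂ (radialFlow t z) := by
  simp [radialFlow]

theorem radialFlow_zero (z : ℂ) : radialFlow 0 z = z := by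
  simp [radialFlow]

theorem radialFlow_of_norm_eq_one (t : ℝ) {z : ℂ} (hz : ‖z‖ = 1) : radialFlow t z = z := by
  simp [radialFlow, hz]

theorem norm_radialFlow_one {z : ℂ} (hz : z ≠ 0) : ‖radialFlow 1 z‖ = 1 := by
  simp [radialFlow, hz]

theorem radialFlow_ne_zero (t : unitInterval) {z : ℂ} (hz : z ≠ 0) : radialFlow t z ≠ 0 := by
  refine mul_ne_zero (Complex.ofReal_ne_zero.2 (ne_of_gt ?_)) hz
  have h : 0 < ‖z‖⁻¹ := inv_pos.2 (norm_pos_iff.2 hz)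
  rcases t.2.2.lt_or_eq with ht | ht
  · have := mul_nonneg t.2.1 h.le
    linarith
  · rw [ht]
    linarith

theorem conjEntries_modelTuple_comp {p : Matrix (Fin n) (Fin n) ℂ × (Fin m → Fin n → ℂ)}
    (hp : p ∈ normalModel m n) {f : ℂ → ℂ}
    (hf : ∀ z, f (starRingEnd ℂ z) = starRingEnd ℂ (f z)) (i : Fin m) :
    conjEntries (modelTuple (p.1, fun i => f ∘ p.2 i) i) =
      modelTuple (p.1, fun i => f ∘ p.2 i) i := by
  have h := hp.2.2.2 i
  unfold modelTuple at h ⊢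
  exact complexify_re_conj_diagonal_comp hp.1 hp.2.1 hf h

/-- The radial deformation of joint eigenvalues. -/
noncomputable def modelFlow (p : normalModel m n × unitInterval) : normalModel m n :=
  ⟨(p.1.1.1, fun i => radialFlow p.2 ∘ p.1.1.2 i), p.1.2.1, p.1.2.2.1,
    fun i k => radialFlow_ne_zero p.2 (p.1.2.2.2.1 i k), fun i =>
      conjEntries_modelTuple_comp p.1.2 (radialFlow_conj p.2) i⟩

theorem continuous_modelFlow :
    Continuous (modelFlow : normalModel m n × unitInterval → normalModel m n) := by
  have hD (i : Fin m) (k : Fin n) :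
      Continuous fun p : normalModel m n × unitInterval => p.1.1.2 i k :=
    (continuous_apply k).comp ((continuous_apply i).comp
      (continuous_snd.comp (continuous_subtype_val.comp continuous_fst)))
  refine Continuous.subtype_mk (Continuous.prodMk
    (continuous_fst.comp (continuous_subtype_val.comp continuous_fst))
    (continuous_pi fun i => continuous_pi fun k => ?_)) _
  have ht : Continuous fun p : normalModel m n × unitInterval => (p.2 : ℝ) :=
    continuous_subtype_val.comp continuous_snd
  refine (Complex.continuous_ofReal.comp ((continuous_const.sub ht).add
    (ht.mul ((hD i k).norm.inv₀ fun p => ?_)))).mul (hD i k)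
  exact norm_ne_zero_iff.2 (p.1.2.2.2.1 i k)

theorem modelClass_modelFlow_eq {p p' : normalModel m n} (h : modelClass p = modelClass p')
    (t : unitInterval) : modelClass (modelFlow (p, t)) = modelClass (modelFlow (p', t)) := by
  obtain ⟨g, hg, hgp⟩ := (conjRel_GLRset_iff _ _).1 (repSpace_mk_eq_iff.1 h)
  refine Quot.sound ((conjRel_GLRset_iff _ _).2 ⟨g, hg, fun i => complexify_injective ?_⟩)
  have hi := congrArg complexify (hgp i)
  rw [complexify_mul, complexify_mul, complexify_realTuple p.2, complexify_realTuple p'.2] at hi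
  rw [complexify_mul, complexify_mul, complexify_realTuple (modelFlow (p, t)).2,
    complexify_realTuple (modelFlow (p', t)).2]
  exact mul_conj_diagonal_comp_of_intertwines (radialFlow t) p.2.2.1 p.2.1 p'.2.2.1 p'.2.1 hi

/-- The deformation of the representation space induced by the radial flow. -/
noncomputable def classFlow (x : RepSpace (GLRset n) (ssTuplesR m n) × unitInterval) :
    RepSpace (GLRset n) (ssTuplesR m n) :=
  modelClass (modelFlow (Function.surjInv modelClass_surjective x.1, x.2))

theorem classFlow_modelClass (p : normalModel m n) (t : unitInterval) :
    classFlow (modelClass p, t) = modelClass (modelFlow (p, t)) :=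
  modelClass_modelFlow_eq (Function.surjInv_eq modelClass_surjective _) t

theorem continuous_classFlow :
    Continuous (classFlow : RepSpace (GLRset n) (ssTuplesR m n) × unitInterval → _) := by
  have hproper : IsProperMap (Prod.map (modelClass : normalModel m n → _)
      (id : unitInterval → unitInterval)) := isProperMap_modelClass.prodMap isProperMap_id
  have hq := hproper.isClosedMap.isQuotientMap hproper.continuous
    (modelClass_surjective.prodMap Function.surjective_id)
  refine hq.continuous_iff.2 ((continuous_modelClass.comp continuous_modelFlow).congr fun p => ?_)
  exact (classFlow_modelClass p.1 p.2).symm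

theorem classFlow_zero (x : RepSpace (GLRset n) (ssTuplesR m n)) : classFlow (x, 0) = x := by
  obtain ⟨p, rfl⟩ := modelClass_surjective x
  rw [classFlow_modelClass]
  congr 1
  refine Subtype.ext (Prod.ext rfl (funext fun i => funext fun k => ?_))
  exact radialFlow_zero _

theorem modelFlow_of_norm_eq_one {p : normalModel m n} (hp : ∀ i k, ‖p.1.2 i k‖ = 1)
    (t : unitInterval) : modelFlow (p, t) = p :=
  Subtype.ext (Prod.ext rfl (funext fun i => funext fun k => radialFlow_of_norm_eq_one t (hp i k)))

theorem realTuple_mem_Oset {p : normalModel m n} (hp : ∀ i k, ‖p.1.2 i k‖ = 1) (i : Fin m) :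
    realTuple p.1 i ∈ Oset n := by
  refine (mem_orthogonalGroup_iff (Fin n) ℝ).2 (complexify_injective ?_)
  have hD : diagonal (p.1.2 i) * (diagonal (p.1.2 i))ᴴ = 1 := by
    rw [diagonal_conjTranspose, diagonal_mul_diagonal, ← diagonal_one]
    congr 1
    ext k
    simp [Complex.mul_conj, Complex.normSq_eq_norm_sq, hp i k]
  change complexify (realTuple p.1 i * (realTuple p.1 i)ᵀ) = _
  rw [complexify_mul, ← conjTranspose_complexify, complexify_realTuple p.2, modelTuple,
    conjTranspose_mul, conjTranspose_mul, conjTranspose_conjTranspose, ← Matrix.mul_assoc p.1.1,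
    conj_mul_conj p.2.2.1, hD, Matrix.mul_one, p.2.1, complexify_one]

/-- The tuple of semisimple matrices underlying a tuple of orthogonal matrices. -/
def orthogonalInclusion (x : commTuples m (Oset n)) : ssTuplesR m n :=
  ⟨x.1, ⟨fun i => IsUnit.of_mul_eq_one _ ((mem_orthogonalGroup_iff (Fin n) ℝ).1 (x.2.1 i)),
    x.2.2⟩, fun i => isSemisimpleMatR_of_mem_Oset (x.2.1 i)⟩

/-- The map of representation spaces induced by the inclusion `O(n) ↪ GL(n,ℝ)`. -/
def orthogonalClassMap :
    RepSpace (Oset n) (commTuples m (Oset n)) → RepSpace (GLRset n) (ssTuplesR m n) :=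
  Quot.map orthogonalInclusion fun _ _ ⟨g, gi, _, _, h₁, h₂, h⟩ =>
    ⟨g, gi, IsUnit.of_mul_eq_one _ h₁, IsUnit.of_mul_eq_one _ h₂, h₁, h₂, h⟩

theorem continuous_orthogonalClassMap : Continuous (orthogonalClassMap (m := m) (n := n)) :=
  continuous_quot_lift _ (continuous_quot_mk.comp (Continuous.subtype_mk continuous_subtype_val _))

theorem orthogonalClassMap_injective :
    Function.Injective (orthogonalClassMap (m := m) (n := n)) := by
  rintro ⟨x⟩ ⟨y⟩ hxy
  obtain ⟨g, hg, h⟩ := (conjRel_GLRset_iff _ _).1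
    ((repSpace_mk_eq_iff (x := orthogonalInclusion x) (y := orthogonalInclusion y)).1 hxy)
  obtain ⟨u, hu, hux⟩ := exists_orthogonal_intertwiner x.2.1 y.2.1 hg h
  have hu' : u * uᵀ = 1 := mul_eq_one_comm.1 hu
  refine Quot.sound ⟨u, uᵀ, (mem_orthogonalGroup_iff' (Fin n) ℝ).2 hu,
    (mem_orthogonalGroup_iff (Fin n) ℝ).2 ?_, hu', hu, fun i => ?_⟩
  · change uᵀ * uᵀᵀ = 1
    rw [transpose_transpose, hu]
  · rw [hux, Matrix.mul_assoc, hu', Matrix.mul_one]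

theorem classFlow_one_mem_range (x : RepSpace (GLRset n) (ssTuplesR m n)) :
    classFlow (x, 1) ∈ Set.range (orthogonalClassMap (m := m) (n := n)) := by
  obtain ⟨p, rfl⟩ := modelClass_surjective x
  rw [classFlow_modelClass]
  have hnorm (i : Fin m) (k : Fin n) : ‖(modelFlow (p, 1)).1.2 i k‖ = 1 :=
    norm_radialFlow_one (p.2.2.2.1 i k)
  exact ⟨Quot.mk _ ⟨realTuple (modelFlow (p, 1)).1, realTuple_mem_Oset hnorm,
    (realTuple_mem (modelFlow (p, 1)).2).1.2⟩, rfl⟩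

theorem classFlow_of_mem_range {x : RepSpace (GLRset n) (ssTuplesR m n)}
    (hx : x ∈ Set.range (orthogonalClassMap (m := m) (n := n))) (t : unitInterval) :
    classFlow (x, t) = x := by
  obtain ⟨⟨k⟩, rfl⟩ := hx
  obtain ⟨p, g, gi, h₁, h₂, h, hp⟩ := exists_modelClass_eq (orthogonalInclusion k)
  change classFlow (Quot.mk _ (orthogonalInclusion k), t) = Quot.mk _ (orthogonalInclusion k)
  rw [← hp, classFlow_modelClass, modelFlow_of_norm_eq_one]
  intro i j
  have hk : (complexify (k.1 i))ᴴ * complexify (k.1 i) = 1 := by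
    rw [conjTranspose_complexify, ← complexify_mul,
      show (k.1 i)ᵀ * k.1 i = 1 from (mem_orthogonalGroup_iff' (Fin n) ℝ).1 (k.2.1 i),
      complexify_one]
  refine norm_eigenvalue_of_unitary (P := complexify gi * p.1.1)
    (Pi := p.1.1ᴴ * complexify g) ?_ ?_ hk j
  · calc p.1.1ᴴ * complexify g * (complexify gi * p.1.1)
        = p.1.1ᴴ * (complexify (g * gi)) * p.1.1 := by
          rw [complexify_mul]; simp only [Matrix.mul_assoc]
      _ = 1 := by rw [h₁, complexify_one, Matrix.mul_one, p.2.2.1]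
  · have hki : k.1 i = gi * realTuple p.1 i * g := by
      calc k.1 i = (gi * g) * k.1 i * (gi * g) := by rw [h₂, Matrix.one_mul, Matrix.mul_one]
        _ = gi * (g * (orthogonalInclusion k).1 i * gi) * g := by
          simp only [orthogonalInclusion, Matrix.mul_assoc]
        _ = _ := by rw [h i]
    rw [hki, complexify_mul, complexify_mul, complexify_realTuple p.2, modelTuple]
    simp only [Matrix.mul_assoc]

end RadialFlow

/-- Theorem 4.3 of Biswas–Florentino for `G = GL(n,ℝ)`, `K = O(n)`:
the map `Hom(ℤ^{2d},O(n))/O(n) → Hom(ℤ^{2d},GL(n,ℝ))⁺/GL(n,ℝ)` induced by the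
inclusion `O(n) ↪ GL(n,ℝ)` is continuous and injective, and its image is a strong
deformation retract of `Hom(ℤ^{2d},GL(n,ℝ))⁺/GL(n,ℝ)`. -/
theorem commuting_tuples_orthogonal_retract_of_generalLinearR (n d : ℕ) (hn : 1 ≤ n) :
    ∃ φ : RepSpace (Oset n) (commTuples (2*d) (Oset n)) →
          RepSpace (GLRset n) (ssTuplesR (2*d) n),
      (∀ x : commTuples (2*d) (Oset n), ∃ y : ssTuplesR (2*d) n,
        (y : Fin (2*d) → Matrix (Fin n) (Fin n) ℝ) = (x : Fin (2*d) → Matrix (Fin n) (Fin n) ℝ)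
          ∧ φ (Quot.mk _ x) = Quot.mk _ y) ∧
      Continuous φ ∧ Function.Injective φ ∧
      IsStrongDeformationRetract (Set.range φ) := by
  exact ⟨orthogonalClassMap, fun x => ⟨orthogonalInclusion x, rfl, rfl⟩,
    continuous_orthogonalClassMap, orthogonalClassMap_injective, classFlow, continuous_classFlow,
    classFlow_zero, classFlow_one_mem_range, fun _ hx t => classFlow_of_mem_range hx t⟩
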